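/- Let ν : Fin d → ℂ be a unit vector, n ≥ 1, and r a natural number with r ≤ n. Then the Hamming-ball projector P^{r,ν} is Hermitian and idempotent (P² = P), and the range of the linear map x ↦ P^{r,ν}·x on ((Fin n → Fin d) → ℂ) equals the quantum Hamming ball Δ_r(ν^{⊗n}), defined as the ℂ-linear span of all vectors of the form π·(ν^{⊗(n−r)} ⊗ u), where u : (Fin r → Fin d) → ℂ ranges over all vectors on the last r subsystems, (ν^{⊗(n−r)} ⊗ u)(x) = (∏_{i < n−r} ν(x i)) · u(j ↦ x(n−r+j)), and π ranges over all permutations of Fin n. -/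

import Mathlib

open Matrix ComplexOrder

/-- Rank-one matrix `v v†`. -/
noncomputable def outer {ι : Type} (v : ι → ℂ) : Matrix ι ι ℂ :=
  Matrix.vecMulVec v (star v)

/-- Hamming-ball projector of radius `r` around `ν^{⊗n}`. -/
noncomputable def hammProj {ι : Type} [Fintype ι] [DecidableEq ι] (n r : ℕ) (ν : ι → ℂ) :
    Matrix (Fin n → ι) (Fin n → ι) ℂ :=
  ∑ E ∈ Finset.univ.filter (fun E : Finset (Fin n) => E.card ≤ r),
    Matrix.of fun x y =>
      ∏ i, (if i ∈ E then (1 - outer ν) else outer ν) (x i) (y i)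

namespace HammAux

set_option linter.unusedSectionVars false

variable {ι : Type} [Fintype ι] [DecidableEq ι] {n : ℕ}

noncomputable def tp (M : Fin n → Matrix ι ι ℂ) : Matrix (Fin n → ι) (Fin n → ι) ℂ :=
  Matrix.of fun x y => ∏ i, M i (x i) (y i)

noncomputable def TE (ν : ι → ℂ) (E : Finset (Fin n)) : Matrix (Fin n → ι) (Fin n → ι) ℂ :=
  tp fun i => if i ∈ E then (1 - outer ν) else outer ν

lemma hamm_eq (r : ℕ) (ν : ι → ℂ) : hammProj n r ν =
    ∑ E ∈ Finset.univ.filter (fun E : Finset (Fin n) => E.card ≤ r), TE ν E := rfl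

lemma tp_mul (M N : Fin n → Matrix ι ι ℂ) : tp M * tp N = tp fun i => M i * N i := by
  ext x y
  simp only [tp, Matrix.mul_apply, Matrix.of_apply, ← Finset.prod_mul_distrib]
  rw [Finset.prod_univ_sum, Fintype.piFinset_univ]

lemma tp_mulVec (M : Fin n → Matrix ι ι ℂ) (v : Fin n → ι → ℂ) (x : Fin n → ι) :
    (tp M *ᵥ fun y => ∏ i, v i (y i)) x = ∏ i, (M i *ᵥ v i) (x i) := by
  simp only [tp, Matrix.mulVec, dotProduct, Matrix.of_apply, ← Finset.prod_mul_distrib]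
  rw [Finset.prod_univ_sum, Fintype.piFinset_univ]

lemma tp_zero (M : Fin n → Matrix ι ι ℂ) (i : Fin n) (h : M i = 0) : tp M = 0 := by
  ext x y
  simp only [tp, Matrix.of_apply, Matrix.zero_apply]
  exact Finset.prod_eq_zero (Finset.mem_univ i) (by simp [h])

lemma dot_one (ν : ι → ℂ) (hν : ∑ i, Complex.normSq (ν i) = 1) : star ν ⬝ᵥ ν = 1 := by
  have : star ν ⬝ᵥ ν = ((∑ i, Complex.normSq (ν i) : ℝ) : ℂ) := by
    simp [dotProduct, Complex.normSq_eq_conj_mul_self]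
  rw [this, hν]; simp

lemma outer_mul (ν : ι → ℂ) (hν : ∑ i, Complex.normSq (ν i) = 1) :
    outer ν * outer ν = outer ν := by
  simp [outer, Matrix.vecMulVec_mul_vecMulVec, dot_one ν hν]

lemma outer_mulVec (ν : ι → ℂ) (hν : ∑ i, Complex.normSq (ν i) = 1) :
    (1 - outer ν) *ᵥ ν = 0 := by
  simp [outer, Matrix.sub_mulVec, Matrix.vecMulVec_mulVec, dot_one ν hν]

lemma outer_herm (ν : ι → ℂ) (a b : ι) : star (outer ν a b) = outer ν b a := by
  simp [outer, Matrix.vecMulVec_apply, mul_comm]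

lemma TE_herm (ν : ι → ℂ) (E : Finset (Fin n)) : (TE ν E).conjTranspose = TE ν E := by
  ext x y
  simp only [TE, tp, Matrix.conjTranspose_apply, Matrix.of_apply, star_prod]
  refine Finset.prod_congr rfl fun i _ => ?_
  split_ifs
  · simp only [Matrix.sub_apply, star_sub, outer_herm]
    congr 1
    simp [Matrix.one_apply, eq_comm]
  · exact outer_herm _ _ _

lemma TE_mul_self (ν : ι → ℂ) (hν : ∑ i, Complex.normSq (ν i) = 1) (E : Finset (Fin n)) :
    TE ν E * TE ν E = TE ν E := by
  simp only [TE, tp_mul]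
  congr 1
  funext i
  split_ifs
  · simp [mul_sub, sub_mul, outer_mul ν hν]
  · exact outer_mul ν hν

lemma TE_mul_ne (ν : ι → ℂ) (hν : ∑ i, Complex.normSq (ν i) = 1) (E F : Finset (Fin n))
    (h : E ≠ F) : TE ν E * TE ν F = 0 := by
  simp only [TE, tp_mul]
  obtain ⟨i, hi⟩ : ∃ i, ¬ (i ∈ E ↔ i ∈ F) := by
    by_contra! hc
    exact h (Finset.ext hc)
  apply tp_zero _ i
  by_cases h1 : i ∈ E <;> by_cases h2 : i ∈ F <;>
    simp_all [mul_sub, sub_mul, outer_mul ν hν]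

lemma TE_sum (ν : ι → ℂ) : ∑ E : Finset (Fin n), TE ν E = 1 := by
  ext x y
  have h := Finset.prod_add (fun i => (1 - outer ν) (x i) (y i)) (fun i => outer ν (x i) (y i))
    (Finset.univ : Finset (Fin n))
  rw [Finset.powerset_univ] at h
  rw [Matrix.sum_apply]
  trans ∏ i, ((1 - outer ν) (x i) (y i) + outer ν (x i) (y i))
  · rw [h]
    refine Finset.sum_congr rfl fun E _ => ?_
    simp only [TE, tp, Matrix.of_apply]
    rw [← Finset.prod_mul_prod_compl E, ← Finset.compl_eq_univ_sdiff]
    congr 1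
    · exact Finset.prod_congr rfl fun i hi => by simp [hi]
    · exact Finset.prod_congr rfl fun i hi => by rw [if_neg (Finset.mem_compl.1 hi)]
  · simp only [Matrix.sub_apply, sub_add_cancel, Matrix.one_apply]
    by_cases hxy : x = y
    · simp [hxy]
    · obtain ⟨i, hi⟩ := Function.ne_iff.1 hxy
      rw [if_neg hxy]
      exact Finset.prod_eq_zero (Finset.mem_univ i) (by simp [hi])

lemma prod_split (m r : ℕ) (h : n = m + r) (f : Fin n → ℂ) :
    ∏ i, f i = (∏ i : Fin m, f ⟨i.val, by omega⟩) * ∏ j : Fin r, f ⟨m + j.val, by omega⟩ := by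
  subst h
  rw [Fin.prod_univ_add]
  rfl

lemma exists_perm (r : ℕ) (hr : r ≤ n) (E : Finset (Fin n)) (hE : E.card ≤ r) :
    ∃ π : Equiv.Perm (Fin n), ∀ i : Fin n, i.val < n - r → π i ∉ E := by
  obtain ⟨F, hEF, hF⟩ := Finset.exists_superset_card_eq hE (by simpa using hr)
  have hc : Fintype.card {i : Fin n // i.val < n - r} = Fintype.card {i : Fin n // i ∉ F} := by
    rw [Fintype.card_subtype_compl]
    have h1 : Fintype.card {i : Fin n // i ∈ F} = r := by simp [hF]
    have h2 : Fintype.card {i : Fin n // i.val < n - r} = n - r := by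
      rw [Fintype.card_subtype, Fin.card_filter_val_lt]
      omega
    rw [h1, h2, Fintype.card_fin]
  refine ⟨(Fintype.equivOfCardEq hc).extendSubtype, fun i hi hiE => ?_⟩
  exact (Fintype.equivOfCardEq hc).extendSubtype_mem i hi (hEF hiE)

lemma lt1 {n r : ℕ} (i : Fin (n - r)) : i.val < n :=
  lt_of_lt_of_le i.2 (Nat.sub_le n r)

lemma lt2 {n r : ℕ} (hr : r ≤ n) (j : Fin r) : n - r + j.val < n :=
  (Nat.add_lt_add_left j.2 (n - r)).trans_eq (Nat.sub_add_cancel hr)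

/-- The generators of the Hamming ball. -/
def gen (r : ℕ) (hr : r ≤ n) (ν : ι → ℂ) (π : Equiv.Perm (Fin n)) (u : (Fin r → ι) → ℂ) :
    (Fin n → ι) → ℂ := fun x =>
  (∏ i : Fin (n - r), ν ((x ∘ π) ⟨i.val, lt1 i⟩)) *
    u (fun j => (x ∘ π) ⟨n - r + j.val, lt2 hr j⟩)

lemma TE_mulVec_gen (r : ℕ) (hr : r ≤ n) (ν : ι → ℂ) (E : Finset (Fin n)) (hE : E.card ≤ r)
    (v : (Fin n → ι) → ℂ) : ∃ π u, TE ν E *ᵥ v = gen r hr ν π u := by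
  obtain ⟨π, hπ⟩ := exists_perm r hr E hE
  refine ⟨π, fun z => ∑ y, ((∏ i : Fin (n - r), star (ν (y (π ⟨i.val, lt1 i⟩)))) *
    ∏ j : Fin r, (if π ⟨n - r + j.val, lt2 hr j⟩ ∈ E then (1 - outer ν) else outer ν) (z j)
      (y (π ⟨n - r + j.val, lt2 hr j⟩))) * v y, ?_⟩
  funext x
  simp only [gen, TE, tp, Matrix.mulVec, dotProduct, Matrix.of_apply, Finset.mul_sum]
  refine Finset.sum_congr rfl fun y _ => ?_
  rw [← Equiv.prod_comp π, prod_split (n - r) r (by omega), ← mul_assoc, ← mul_assoc,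
    ← Finset.prod_mul_distrib]
  congr 2
  refine Finset.prod_congr rfl fun i _ => ?_
  rw [if_neg (hπ _ i.2)]
  simp [outer, Matrix.vecMulVec_apply]

/-- Local factors of the product vectors spanning the generators. -/
noncomputable def loc (r : ℕ) (ν : ι → ℂ) (π : Equiv.Perm (Fin n)) (z : Fin r → ι)
    (i : Fin n) : ι → ℂ :=
  if h : (π.symm i).val < n - r then ν
  else Pi.single (z ⟨(π.symm i).val - (n - r), by omega⟩) 1

lemma gen_eq (r : ℕ) (hr : r ≤ n) (ν : ι → ℂ) (π : Equiv.Perm (Fin n)) (u : (Fin r → ι) → ℂ) :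
    gen r hr ν π u = ∑ z, u z • (fun y => ∏ i, loc r ν π z i (y i)) := by
  funext x
  simp only [gen, Finset.sum_apply, Pi.smul_apply, smul_eq_mul]
  have key : ∀ z, ∏ i, loc r ν π z i (x i) =
      (∏ i : Fin (n - r), ν ((x ∘ π) ⟨i.val, lt1 i⟩)) *
        if z = (fun j : Fin r => (x ∘ π) ⟨n - r + j.val, lt2 hr j⟩) then 1 else 0 := by
    intro z
    rw [← Equiv.prod_comp π, prod_split (n - r) r (by omega)]
    congr 1
    · refine Finset.prod_congr rfl fun i _ => ?_
      simp [loc]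
    · trans ∏ j : Fin r, if z j = x (π ⟨n - r + j.val, lt2 hr j⟩) then (1 : ℂ) else 0
      · refine Finset.prod_congr rfl fun j _ => ?_
        simp [loc, Pi.single_apply, eq_comm]
      · rw [Finset.prod_ite_zero]
        simp [funext_iff]
  simp only [key]
  rw [Finset.sum_eq_single (fun j : Fin r => (x ∘ π) ⟨n - r + j.val, lt2 hr j⟩)]
  · simp [mul_comm]
  · intro b _ hb
    rw [if_neg hb]; simp
  · simp

lemma TE_gen (r : ℕ) (hr : r ≤ n) (ν : ι → ℂ) (hν : ∑ i, Complex.normSq (ν i) = 1)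
    (π : Equiv.Perm (Fin n)) (u : (Fin r → ι) → ℂ)
    (E : Finset (Fin n)) (hE : ¬ E.card ≤ r) : TE ν E *ᵥ gen r hr ν π u = 0 := by
  obtain ⟨i, hiE, hi⟩ : ∃ i ∈ E, (π.symm i).val < n - r := by
    by_contra! hc
    apply hE
    have := Finset.card_le_card_of_injOn (s := E) (t := Finset.Ico (n - r) n)
      (fun i => (π.symm i).val) (fun i hi => by
        have := hc i hi
        simp only [Finset.coe_Ico, Set.mem_Ico]
        omega)
      (fun a _ b _ hab => π.symm.injective (Fin.ext hab))
    simp only [Nat.card_Ico] at this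
    omega
  rw [gen_eq, Matrix.mulVec_sum]
  refine Finset.sum_eq_zero fun z _ => ?_
  rw [Matrix.mulVec_smul]
  convert smul_zero _
  funext x
  rw [TE, tp_mulVec]
  apply Finset.prod_eq_zero (Finset.mem_univ i)
  simp [hiE, loc, hi, outer_mulVec ν hν]

end HammAux

/-- the Hamming-ball projector is an orthogonal projection whose
range is the quantum Hamming ball `Δ_r(ν^{⊗n})`, i.e. the span of the permuted
vectors `π·(ν^{⊗(n−r)} ⊗ u)`. -/
theorem stmt4 {d : ℕ} (ν : Fin d → ℂ) (hν : ∑ i, Complex.normSq (ν i) = 1)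
    (n : ℕ) (hn : 1 ≤ n) (r : ℕ) (hr : r ≤ n) :
    (hammProj n r ν).IsHermitian ∧
    hammProj n r ν * hammProj n r ν = hammProj n r ν ∧
    LinearMap.range (Matrix.mulVecLin (hammProj n r ν)) =
      Submodule.span ℂ
        { w : (Fin n → Fin d) → ℂ |
          ∃ (π : Equiv.Perm (Fin n)) (u : (Fin r → Fin d) → ℂ),
            w = fun x =>
              (∏ i : Fin (n - r), ν ((x ∘ π) ⟨i.val, by omega⟩)) *
                u (fun j => (x ∘ π) ⟨n - r + j.val, by omega⟩) } := by
  classical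
  have hid : hammProj n r ν * hammProj n r ν = hammProj n r ν := by
    rw [HammAux.hamm_eq, Finset.sum_mul_sum]
    refine Finset.sum_congr rfl fun E hE => ?_
    rw [Finset.sum_eq_single E, HammAux.TE_mul_self ν hν]
    · intro F _ hF
      exact HammAux.TE_mul_ne ν hν E F hF.symm
    · exact fun h => absurd hE h
  refine ⟨?_, hid, le_antisymm ?_ ?_⟩
  · rw [Matrix.IsHermitian, HammAux.hamm_eq, Matrix.conjTranspose_sum]
    exact Finset.sum_congr rfl fun E _ => HammAux.TE_herm ν E
  · rintro _ ⟨v, rfl⟩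
    rw [Matrix.mulVecLin_apply, HammAux.hamm_eq, Matrix.sum_mulVec]
    refine Submodule.sum_mem _ fun E hE => Submodule.subset_span ?_
    exact HammAux.TE_mulVec_gen r hr ν E (Finset.mem_filter.1 hE).2 v
  · rw [Submodule.span_le]
    rintro _ ⟨π, u, rfl⟩
    refine ⟨HammAux.gen r hr ν π u, ?_⟩
    change _ = HammAux.gen r hr ν π u
    rw [Matrix.mulVecLin_apply, HammAux.hamm_eq, Matrix.sum_mulVec]
    conv_rhs => rw [← Matrix.one_mulVec (HammAux.gen r hr ν π u), ← HammAux.TE_sum ν,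
      Matrix.sum_mulVec]
    refine Finset.sum_subset (Finset.filter_subset _ _) fun E _ hE => ?_
    exact HammAux.TE_gen r hr ν hν π u E (by simpa using hE)
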